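/- arXiv:2506.03125 — 3 statements merged into one kernel-verified Lean document; each statement's English description precedes it below -/
import Mathlib

section
/- Every left invariant derivation of H commutes with every right invariant derivation of H: if D is a left invariant derivation and E is a right invariant derivation, then D∘E = E∘D as linear maps H → H. -/
open TensorProduct

variable (k : Type*) [Field k]
variable (H : Type*) [CommRing H] [HopfAlgebra k H]

/-- A derivation of `H`: a `k`-linear map satisfying the Leibniz rule. -/
def IsDerivation (D : H →ₗ[k] H) : Prop :=
  ∀ f g : H, D (f * g) = D f * g + f * D g

/-- A left invariant linear map: `Δ ∘ D = (id ⊗ D) ∘ Δ`. -/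
def IsLeftInvariant (D : H →ₗ[k] H) : Prop :=
  (Coalgebra.comul (R := k)) ∘ₗ D = LinearMap.lTensor H D ∘ₗ (Coalgebra.comul (R := k))

/-- A right invariant linear map: `Δ ∘ D = (D ⊗ id) ∘ Δ`. -/
def IsRightInvariant (D : H →ₗ[k] H) : Prop :=
  (Coalgebra.comul (R := k)) ∘ₗ D = LinearMap.rTensor H D ∘ₗ (Coalgebra.comul (R := k))

/-- A differentiation of `H`: `ν (f g) = ν f · ε g + ε f · ν g`. -/
def IsDifferentiation (ν : H →ₗ[k] k) : Prop :=
  ∀ f g : H, ν (f * g) = ν f * Coalgebra.counit g + Coalgebra.counit f * ν g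

/-- `X_ν = (id ⊗ ν) ∘ Δ`. -/
noncomputable def Xder (ν : H →ₗ[k] k) : H →ₗ[k] H :=
  (TensorProduct.rid k H).toLinearMap ∘ₗ LinearMap.lTensor H ν ∘ₗ (Coalgebra.comul (R := k))

/-- `Y_ν = (ν ⊗ id) ∘ Δ`. -/
noncomputable def Yder (ν : H →ₗ[k] k) : H →ₗ[k] H :=
  (TensorProduct.lid k H).toLinearMap ∘ₗ LinearMap.rTensor H ν ∘ₗ (Coalgebra.comul (R := k))

theorem stmt4 (D E : H →ₗ[k] H) (hD : IsDerivation k H D) (hDL : IsLeftInvariant k H D)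
    (hE : IsDerivation k H E) (hER : IsRightInvariant k H E) :
    D ∘ₗ E = E ∘ₗ D := by
  have comul_injective : Function.Injective (Coalgebra.comul (R := k) (A := H)) := by
    intro x y h
    have h' := congrArg (LinearMap.rTensor H (Coalgebra.counit (R := k) (A := H))) h
    rw [Coalgebra.rTensor_counit_comul, Coalgebra.rTensor_counit_comul] at h'
    simpa using congrArg (TensorProduct.lid k H) h'
  rw [← LinearMap.cancel_left comul_injective]
  calc Coalgebra.comul ∘ₗ D ∘ₗ E
      = LinearMap.lTensor H D ∘ₗ LinearMap.rTensor H E ∘ₗ Coalgebra.comul := by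
        rw [← LinearMap.comp_assoc, hDL, LinearMap.comp_assoc, hER]
    _ = LinearMap.rTensor H E ∘ₗ LinearMap.lTensor H D ∘ₗ Coalgebra.comul := by
        rw [← LinearMap.comp_assoc, LinearMap.lTensor_comp_rTensor,
          ← LinearMap.rTensor_comp_lTensor, LinearMap.comp_assoc]
    _ = Coalgebra.comul ∘ₗ E ∘ₗ D := by
        rw [← hDL, ← LinearMap.comp_assoc, ← hER, LinearMap.comp_assoc]
end

section
/- Assume H is finitely generated as a k-algebra and let L denote the k-vector space of all differentiations of H. Then the k-linear map H ⊗ L → Der_k(H), f ⊗ ν ↦ f·X_ν (where (f·X_ν)(h) = f·X_ν(h)), is bijective; it is an isomorphism of H-modules from H ⊗ L onto the H-module of all derivations of H. -/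
open TensorProduct

variable (k : Type*) [Field k]
variable (H : Type*) [CommRing H] [HopfAlgebra k H]

/-- The `k`-vector space of differentiations of `H`, as a submodule of `H →ₗ[k] k`. -/
def Differentiations : Submodule k (H →ₗ[k] k) where
  carrier := {ν | IsDifferentiation k H ν}
  add_mem' := by
    intro a b ha hb f g
    simp only [LinearMap.add_apply, ha f g, hb f g]
    ring
  zero_mem' := by
    intro f g
    simp
  smul_mem' := by
    intro c a ha f g
    simp only [LinearMap.smul_apply, ha f g, smul_eq_mul]
    ring

lemma Xder_add (ν μ : H →ₗ[k] k) : Xder k H (ν + μ) = Xder k H ν + Xder k H μ := by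
  unfold Xder
  rw [LinearMap.lTensor_add, LinearMap.add_comp, LinearMap.comp_add]

lemma Xder_smul (c : k) (ν : H →ₗ[k] k) : Xder k H (c • ν) = c • Xder k H ν := by
  unfold Xder
  rw [LinearMap.lTensor_smul, LinearMap.smul_comp, LinearMap.comp_smul]

/-- The map `H ⊗ L → End(H)`, `f ⊗ ν ↦ f • X_ν`. -/
noncomputable def PhiX : H ⊗[k] (Differentiations k H) →ₗ[k] (H →ₗ[k] H) :=
  TensorProduct.lift <| LinearMap.mk₂ k
    (fun f ν => f • Xder k H ν.1)
    (fun f g ν => add_smul f g _)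
    (fun c f ν => smul_assoc c f _)
    (fun f ν μ => by
      show f • Xder k H ((ν + μ : Differentiations k H) : H →ₗ[k] k) = _
      rw [Submodule.coe_add, Xder_add, smul_add])
    (fun f c ν => by
      show c • Xder k H ((f • ν : Differentiations k H) : H →ₗ[k] k) = _
      rw [Submodule.coe_smul, Xder_smul]
      ext x
      simp [mul_smul_comm])

open Coalgebra WithConv

section

variable {k H}

/-- Convolving a multiplicative map `α` with a `γ`-derivation gives an `α * γ`-derivation. -/
lemma convMul_leibniz {A : Type*} [CommRing A] [Algebra k A] {α β γ : H →ₗ[k] A}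
    (hα : ∀ x y, α (x * y) = α x * α y)
    (hβ : ∀ x y, β (x * y) = β x * γ y + γ x * β y) (x y : H) :
    (toConv α * toConv β) (x * y) =
      (toConv α * toConv β) x * (toConv α * toConv γ) y +
        (toConv α * toConv γ) x * (toConv α * toConv β) y := by
  simp only [LinearMap.convMul_apply, Bialgebra.comul_mul]
  generalize comul (R := k) x = u
  generalize comul (R := k) y = v
  induction u with
  | zero => simp
  | add u₁ u₂ h₁ h₂ => simp only [add_mul, map_add, h₁, h₂]; ring
  | tmul a b =>
    induction v with
    | zero => simp
    | add v₁ v₂ h₁ h₂ => simp only [mul_add, map_add, h₁, h₂]; ring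
    | tmul c d =>
      simp only [Algebra.TensorProduct.tmul_mul_tmul, TensorProduct.map_tmul,
        LinearMap.mul'_apply, hα, hβ]
      ring

/-- An `H`-valued differentiation: a derivation along the counit. -/
def IsCounitDerivation (E : H →ₗ[k] H) : Prop :=
  ∀ x y : H, E (x * y) = E x * algebraMap k H (counit y) + algebraMap k H (counit x) * E y

lemma IsCounitDerivation.isDerivation_convMul {E : H →ₗ[k] H} (hE : IsCounitDerivation E) :
    IsDerivation k H (toConv LinearMap.id * toConv E).ofConv := by
  intro x y
  have h := convMul_leibniz (α := LinearMap.id) (β := E)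
    (γ := Algebra.linearMap k H ∘ₗ counit) (fun _ _ => rfl) hE x y
  rwa [← LinearMap.convOne_def, mul_one] at h

lemma IsDerivation.isCounitDerivation_convMul {D : H →ₗ[k] H} (hD : IsDerivation k H D) :
    IsCounitDerivation (toConv (HopfAlgebra.antipode k (A := H)) * toConv D).ofConv := by
  intro x y
  have h := convMul_leibniz (α := HopfAlgebra.antipode k (A := H)) (β := D)
    (γ := LinearMap.id) HopfAlgebra.antipode_mul_distrib hD x y
  rwa [LinearMap.antipode_mul_id] at h

lemma IsCounitDerivation.finiteDimensional_range [Algebra.FiniteType k H] {E : H →ₗ[k] H}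
    (hE : IsCounitDerivation E) : FiniteDimensional k (LinearMap.range E) := by
  obtain ⟨s, hs⟩ := Algebra.FiniteType.out (R := k) (A := H)
  have h_one : E 1 = 0 := by simpa using hE 1 1
  suffices h : LinearMap.range E ≤ Submodule.span k (E '' (s : Set H)) by
    have := FiniteDimensional.span_of_finite k (s.finite_toSet.image E)
    exact Submodule.finiteDimensional_of_le h
  rintro _ ⟨x, rfl⟩
  have hx : x ∈ Algebra.adjoin k (s : Set H) := hs ▸ Algebra.mem_top
  induction hx using Algebra.adjoin_induction with
  | mem x hx => exact Submodule.subset_span ⟨x, hx, rfl⟩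
  | algebraMap r => simp [Algebra.algebraMap_eq_smul_one, h_one]
  | add x y _ _ hx hy => rw [map_add]; exact add_mem hx hy
  | mul x y _ _ hx hy =>
    rw [hE, mul_comm (E x), ← Algebra.smul_def, ← Algebra.smul_def]
    exact add_mem (Submodule.smul_mem _ _ hx) (Submodule.smul_mem _ _ hy)

variable (k H) in
/-- The map `H ⊗ L → End(H)` sending `f ⊗ ν` to `h ↦ ν h • f`. -/
noncomputable def differentiationTensorHom : H ⊗[k] Differentiations k H →ₗ[k] (H →ₗ[k] H) :=
  TensorProduct.lift
    ((LinearMap.smulRightₗ (R := k) (M₂ := H) (M := H)).flip.compl₂ (Differentiations k H).subtype)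

@[simp]
lemma differentiationTensorHom_tmul (f : H) (ν : Differentiations k H) (h : H) :
    differentiationTensorHom k H (f ⊗ₜ ν) h = ν.1 h • f := rfl

lemma differentiationTensorHom_injective :
    Function.Injective (differentiationTensorHom k H) := by
  classical
  rw [injective_iff_map_eq_zero]
  intro t ht
  let b := Module.Basis.ofVectorSpace k H
  have key : ∀ (u : H ⊗[k] Differentiations k H) (i) (h : H),
      b.repr (differentiationTensorHom k H u h) i =
        (TensorProduct.equivFinsuppOfBasisLeft b u i).1 h := by
    intro u i h
    induction u with
    | zero => simp
    | add u v hu hv => simp [hu, hv]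
    | tmul f ν => simp [mul_comm]
  apply (TensorProduct.equivFinsuppOfBasisLeft b).injective
  ext i h
  rw [← key, ht]
  simp

lemma isCounitDerivation_differentiationTensorHom (t : H ⊗[k] Differentiations k H) :
    IsCounitDerivation (differentiationTensorHom k H t) := by
  intro x y
  induction t with
  | zero => simp
  | add u v hu hv => simp only [map_add, LinearMap.add_apply, hu, hv]; ring
  | tmul f ν =>
    simp only [differentiationTensorHom_tmul, ν.2 x y, Algebra.smul_def, map_add, map_mul]
    ring

lemma IsCounitDerivation.mem_range [Algebra.FiniteType k H] {E : H →ₗ[k] H}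
    (hE : IsCounitDerivation E) : ∃ t, differentiationTensorHom k H t = E := by
  have := hE.finiteDimensional_range
  let b := Module.finBasis k (LinearMap.range E)
  have h_mul (x y : H) : E.rangeRestrict (x * y) =
      counit (R := k) y • E.rangeRestrict x + counit (R := k) x • E.rangeRestrict y := by
    apply Subtype.ext
    simp [hE x y, Algebra.smul_def, mul_comm]
  let ν (i) : Differentiations k H := ⟨b.coord i ∘ₗ E.rangeRestrict, fun x y => by
    rw [LinearMap.comp_apply, h_mul]
    simp [mul_comm]⟩
  refine ⟨∑ i, (b i : H) ⊗ₜ ν i, LinearMap.ext fun h => ?_⟩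
  have h_repr := congr(Subtype.val $(b.sum_repr (E.rangeRestrict h)))
  rw [Submodule.coe_sum] at h_repr
  simpa only [map_sum, LinearMap.sum_apply] using! h_repr

lemma PhiX_eq_convMul (t : H ⊗[k] Differentiations k H) :
    PhiX k H t =
      (toConv LinearMap.id * toConv (differentiationTensorHom k H t)).ofConv := by
  induction t with
  | zero => simp
  | add u v hu hv => rw [map_add, map_add, hu, hv, toConv_add, mul_add, ofConv_add]
  | tmul f ν =>
    ext h
    change f * TensorProduct.rid k H (LinearMap.lTensor H ν.1 (comul h)) =
      LinearMap.mul' k H (TensorProduct.map LinearMap.id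
        (differentiationTensorHom k H (f ⊗ₜ ν)) (comul h))
    generalize comul (R := k) h = u
    induction u with
    | zero => simp
    | add u v hu hv => simp only [map_add, mul_add, hu, hv]
    | tmul a b => simp [mul_comm]

end

theorem stmt6 [Algebra.FiniteType k H] :
    Function.Injective (PhiX k H) ∧
    Set.range (PhiX k H) = {D : H →ₗ[k] H | IsDerivation k H D} ∧
    ∀ (a : H) (t : H ⊗[k] (Differentiations k H)), PhiX k H (a • t) = a • PhiX k H t := by
  refine ⟨fun t u h => ?_, Set.ext fun D => ⟨?_, fun hD => ?_⟩, fun a t => ?_⟩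
  · simp only [PhiX_eq_convMul] at h
    have h' := congr(toConv (HopfAlgebra.antipode k (A := H)) * toConv $h)
    simp only [toConv_ofConv, ← mul_assoc, LinearMap.antipode_mul_id, one_mul] at h'
    exact differentiationTensorHom_injective (toConv_injective h')
  · rintro ⟨t, rfl⟩
    rw [PhiX_eq_convMul]
    exact (isCounitDerivation_differentiationTensorHom t).isDerivation_convMul
  · obtain ⟨t, ht⟩ := (IsDerivation.isCounitDerivation_convMul hD).mem_range
    refine ⟨t, ?_⟩
    rw [PhiX_eq_convMul, ht, toConv_ofConv, ← mul_assoc, LinearMap.id_mul_antipode, one_mul]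
  · induction t with
    | zero => simp
    | add u v hu hv => rw [smul_add, map_add, map_add, hu, hv, smul_add]
    | tmul f ν => exact mul_smul a f (Xder k H ν.1)
end

section
/- Assume H is finitely generated as a k-algebra and let L denote the k-vector space of all differentiations of H. Then the k-linear map H ⊗ L → Der_k(H), f ⊗ ν ↦ f·Y_ν (where (f·Y_ν)(h) = f·Y_ν(h)), is bijective; it is an isomorphism of H-modules from H ⊗ L onto the H-module of all derivations of H. -/
open TensorProduct

variable (k : Type*) [Field k]
variable (H : Type*) [CommRing H] [HopfAlgebra k H]

lemma Yder_add (ν μ : H →ₗ[k] k) : Yder k H (ν + μ) = Yder k H ν + Yder k H μ := by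
  unfold Yder
  rw [LinearMap.rTensor_add, LinearMap.add_comp, LinearMap.comp_add]

lemma Yder_smul (c : k) (ν : H →ₗ[k] k) : Yder k H (c • ν) = c • Yder k H ν := by
  unfold Yder
  rw [LinearMap.rTensor_smul, LinearMap.smul_comp, LinearMap.comp_smul]

/-- The map `H ⊗ L → End(H)`, `f ⊗ ν ↦ f • Y_ν`. -/
noncomputable def PhiY : H ⊗[k] (Differentiations k H) →ₗ[k] (H →ₗ[k] H) :=
  TensorProduct.lift <| LinearMap.mk₂ k
    (fun f ν => f • Yder k H ν.1)
    (fun f g ν => add_smul f g _)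
    (fun c f ν => smul_assoc c f _)
    (fun f ν μ => by
      show f • Yder k H ((ν + μ : Differentiations k H) : H →ₗ[k] k) = _
      rw [Submodule.coe_add, Yder_add, smul_add])
    (fun f c ν => by
      show c • Yder k H ((f • ν : Differentiations k H) : H →ₗ[k] k) = _
      rw [Submodule.coe_smul, Yder_smul]
      ext x
      simp [mul_smul_comm])

section Convolution

open Coalgebra WithConv

variable {k H}

/-- A linear map satisfying the Leibniz rule relative to `α`, convolved with a multiplicative map
`B`, satisfies the Leibniz rule relative to `α * B`. -/
lemma convMul_leibniz_s7 {A α B : WithConv (H →ₗ[k] H)}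
    (hA : ∀ f g, A (f * g) = A f * α g + α f * A g)
    (hB : ∀ f g, B (f * g) = B f * B g) (f g : H) :
    (A * B) (f * g) = (A * B) f * (α * B) g + (α * B) f * (A * B) g := by
  rw [((ℛ k f).mul (ℛ k g)).convMul_apply, (ℛ k f).convMul_apply, (ℛ k f).convMul_apply,
    (ℛ k g).convMul_apply, (ℛ k g).convMul_apply, Finset.sum_mul_sum, Finset.sum_mul_sum,
    ← Finset.sum_product', ← Finset.sum_product', ← Finset.sum_add_distrib]
  refine Finset.sum_congr rfl fun x _ => ?_
  simp only [Repr.mul_left, Repr.mul_right, hA, hB]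
  ring

/-- Convolving a derivation with the antipode gives a derivation at the counit. -/
lemma IsDerivation.convMul_antipode {D : H →ₗ[k] H} (hD : IsDerivation k H D) (f g : H) :
    (toConv D * toConv (HopfAlgebra.antipode k) : WithConv (H →ₗ[k] H)) (f * g) =
      counit (R := k) g • (toConv D * toConv (HopfAlgebra.antipode k) : WithConv (H →ₗ[k] H)) f +
        counit (R := k) f • (toConv D * toConv (HopfAlgebra.antipode k) : WithConv (H →ₗ[k] H)) g := by
  have h := convMul_leibniz_s7 (A := toConv D) (α := toConv LinearMap.id)
    (B := toConv (HopfAlgebra.antipode k)) hD HopfAlgebra.antipode_mul_distrib f g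
  rw [h, LinearMap.id_mul_antipode, LinearMap.convOne_apply, LinearMap.convOne_apply,
    Algebra.smul_def, Algebra.smul_def, mul_comm (algebraMap k H (counit g))]

lemma Yder_eq_convMul (ν : H →ₗ[k] k) :
    Yder k H ν = (toConv (Algebra.linearMap k H ∘ₗ ν) * toConv LinearMap.id).ofConv := by
  rw [Yder, LinearMap.convMul_def, ← LinearMap.comp_assoc, ← LinearMap.comp_assoc]
  congr 1
  ext x y
  simp [Algebra.smul_def]

lemma IsDifferentiation.isDerivation_Yder {ν : H →ₗ[k] k} (hν : IsDifferentiation k H ν) :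
    IsDerivation k H (Yder k H ν) := by
  intro f g
  have h := convMul_leibniz_s7 (A := toConv (Algebra.linearMap k H ∘ₗ ν)) (α := 1)
    (B := toConv LinearMap.id) (fun f g => by simp [hν f g]) (fun _ _ => rfl) f g
  rw [one_mul] at h
  rw [Yder_eq_convMul]
  exact h

lemma IsDifferentiation.map_one {ν : H →ₗ[k] k} (hν : IsDifferentiation k H ν) : ν 1 = 0 := by
  simpa using hν 1 1

/-- A differentiation vanishing on a set of algebra generators is zero. -/
lemma IsDifferentiation.eq_zero_of_adjoin_eq_top {ν : H →ₗ[k] k} (hν : IsDifferentiation k H ν)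
    {s : Set H} (hs : Algebra.adjoin k s = ⊤) (h : ∀ x ∈ s, ν x = 0) : ν = 0 := by
  ext x
  have hx : x ∈ Algebra.adjoin k s := hs ▸ Algebra.mem_top
  induction hx using Algebra.adjoin_induction with
  | mem x hx => exact h x hx
  | algebraMap r => simp [Algebra.algebraMap_eq_smul_one, hν.map_one]
  | add x y _ _ hx hy => simp_all
  | mul x y _ _ hx hy => simp_all [hν x y]

end Convolution

section Comparison

open Coalgebra WithConv Module

/-- The map `H ⊗ L → End(H)` sending `f ⊗ ν` to `h ↦ ν(h) f`. -/
noncomputable def differentiationHom :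
    H ⊗[k] (Differentiations k H) →ₗ[k] (H →ₗ[k] H) :=
  TensorProduct.lift ((LinearMap.lcomp k (H →ₗ[k] H) (Differentiations k H).subtype) ∘ₗ
    (LinearMap.smulRightₗ (R := k) (M := H) (M₂ := H)).flip)

variable {k H}

lemma differentiationHom_tmul_apply (f : H) (ν : Differentiations k H) (h : H) :
    differentiationHom k H (f ⊗ₜ ν) h = ν.1 h • f := by
  simp [differentiationHom]

lemma PhiY_tmul (f : H) (ν : Differentiations k H) :
    PhiY k H (f ⊗ₜ ν) = f • Yder k H ν.1 := by
  simp [PhiY]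

lemma PhiY_smul (a : H) (t : H ⊗[k] (Differentiations k H)) :
    PhiY k H (a • t) = a • PhiY k H t := by
  induction t with
  | zero => simp
  | tmul f ν => rw [TensorProduct.smul_tmul', PhiY_tmul, PhiY_tmul, smul_eq_mul, mul_smul]
  | add x y hx hy => rw [smul_add, map_add, hx, hy, map_add, smul_add]

lemma isDerivation_PhiY (t : H ⊗[k] (Differentiations k H)) :
    IsDerivation k H (PhiY k H t) := by
  induction t with
  | zero => intro f g; simp
  | tmul f ν =>
    intro g h
    simp only [PhiY_tmul, LinearMap.smul_apply, smul_eq_mul, ν.2.isDerivation_Yder g h]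
    ring
  | add x y hx hy =>
    intro f g
    simp only [map_add, LinearMap.add_apply, hx f g, hy f g]
    ring

lemma PhiY_eq_convMul (t : H ⊗[k] (Differentiations k H)) :
    toConv (PhiY k H t) = toConv (differentiationHom k H t) * toConv LinearMap.id := by
  induction t with
  | zero => simp
  | tmul f ν =>
    rw [PhiY_tmul, Yder_eq_convMul, toConv_smul, toConv_ofConv, ← smul_mul_assoc]
    congr 1
    ext h
    change f * algebraMap k H (ν.1 h) = differentiationHom k H (f ⊗ₜ ν) h
    rw [differentiationHom_tmul_apply, Algebra.smul_def, mul_comm]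
  | add x y hx hy => simp only [map_add, toConv_add, hx, hy, add_mul]

lemma repr_differentiationHom {ι : Type*} [DecidableEq ι] (b : Basis ι k H)
    (t : H ⊗[k] (Differentiations k H)) (h : H) (i : ι) :
    b.repr (differentiationHom k H t h) i =
      (TensorProduct.equivFinsuppOfBasisLeft b t i).1 h := by
  induction t with
  | zero => simp
  | tmul f ν => simp [differentiationHom_tmul_apply, mul_comm]
  | add x y hx hy => simp [hx, hy]

lemma differentiationHom_injective : Function.Injective (differentiationHom k H) := by
  classical
  rw [injective_iff_map_eq_zero]
  intro t ht
  let b := Basis.ofVectorSpace k H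
  apply (TensorProduct.equivFinsuppOfBasisLeft b).injective
  ext i h
  simp [← repr_differentiationHom, ht]

/-- If `H` is finitely generated, every derivation at the counit with values in `H` is a finite
sum of differentiations with coefficients in `H`. -/
lemma exists_differentiationHom_eq [Algebra.FiniteType k H] {E : H →ₗ[k] H}
    (hE : ∀ f g, E (f * g) = counit (R := k) g • E f + counit (R := k) f • E g) :
    ∃ t, differentiationHom k H t = E := by
  classical
  obtain ⟨s, hs⟩ := Algebra.FiniteType.out (R := k) (A := H)
  let b := Basis.ofVectorSpace k H
  have hν : ∀ i, IsDifferentiation k H (b.coord i ∘ₗ E) := fun i f g => by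
    simp [hE f g, mul_comm]
  let ν : Basis.ofVectorSpaceIndex k H →₀ Differentiations k H :=
    Finsupp.onFinset (s.biUnion fun x => (b.repr (E x)).support)
      (fun i => ⟨b.coord i ∘ₗ E, hν i⟩) (by
        intro i hi
        contrapose! hi
        refine Subtype.ext ((hν i).eq_zero_of_adjoin_eq_top hs fun x hx => ?_)
        by_contra hne
        exact hi (Finset.mem_biUnion.2 ⟨x, hx, Finsupp.mem_support_iff.2 hne⟩))
  refine ⟨(TensorProduct.equivFinsuppOfBasisLeft b).symm ν, ?_⟩
  ext h
  apply b.repr.injective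
  ext i
  rw [repr_differentiationHom, LinearEquiv.apply_symm_apply]
  rfl

end Comparison

theorem stmt7 [Algebra.FiniteType k H] :
    Function.Injective (PhiY k H) ∧
    Set.range (PhiY k H) = {D : H →ₗ[k] H | IsDerivation k H D} ∧
    ∀ (a : H) (t : H ⊗[k] (Differentiations k H)), PhiY k H (a • t) = a • PhiY k H t := by
  refine ⟨fun t u htu => ?_, Set.Subset.antisymm ?_ fun D hD => ?_, PhiY_smul⟩
  · apply differentiationHom_injective
    apply WithConv.toConv_injective
    have h := congrArg
      (fun D => WithConv.toConv D * WithConv.toConv (HopfAlgebra.antipode k (A := H))) htu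
    simpa only [PhiY_eq_convMul, mul_assoc, LinearMap.id_mul_antipode, mul_one] using h
  · rintro _ ⟨t, rfl⟩
    exact isDerivation_PhiY t
  · obtain ⟨t, ht⟩ := exists_differentiationHom_eq (IsDerivation.convMul_antipode hD)
    refine ⟨t, WithConv.toConv_injective ?_⟩
    rw [PhiY_eq_convMul, ht, WithConv.toConv_ofConv, mul_assoc, LinearMap.antipode_mul_id, mul_one]
end
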